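/- Proposition 1 (lens bound for one chord of a spiral): Let γ be a unit-speed plane curve whose signed curvature k is nondecreasing on [s₀, s₃], let s₀ < s₁ < s₂ < s₃, and set Pᵢ = γ(sᵢ) (assumed pairwise distinct). Let v = P₂ − P₁, c = ‖v‖/2, v̂ = v/‖v‖, and M = (P₁ + P₂)/2. Assume each of the three arcs is one-to-one projectable onto its chord, i.e. ⟨γ'(s), (P_{i+1} − P_i)/‖P_{i+1} − P_i‖⟩ > 0 for all s ∈ [s_i, s_{i+1}], i = 0, 1, 2. Assume further ‖P₁ − P₀‖² + ⟨P₁ − P₀, P₂ − P₁⟩ ≥ 0 and ‖P₃ − P₂‖² + ⟨P₂ − P₁, P₃ − P₂⟩ ≥ 0, and define ξ = arcsin(−c·q(P₀, P₁, P₂)) and η = arcsin(c·q(P₁, P₂, P₃)). Then for every s ∈ [s₁, s₂], writing u = ⟨γ(s) − M, v̂⟩ and w = det(v̂, γ(s) − M), one has A(u; c, −η) ≤ w ≤ A(u; c, ξ); that is, the spiral segment between P₁ and P₂ lies in the lens on the chord P₁P₂ bounded by the circular arcs with tangent angles ξ and −η. -/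

import Mathlib

open scoped InnerProductSpace

/-- Planar cross product: `det((a₁,a₂),(b₁,b₂)) = a₁·b₂ − a₂·b₁`. -/
noncomputable def det2 (a b : EuclideanSpace ℝ (Fin 2)) : ℝ :=
  a 0 * b 1 - a 1 * b 0

/-- Signed curvature of a unit-speed plane curve: `k(s) = det(γ'(s), γ''(s))`. -/
noncomputable def signedCurv (γ : ℝ → EuclideanSpace ℝ (Fin 2)) (s : ℝ) : ℝ :=
  det2 (deriv γ s) (deriv (deriv γ) s)

/-- Signed curvature of the directed circle through three pairwise distinct
points `A`, `B`, `C`. -/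
noncomputable def q3 (A B C : EuclideanSpace ℝ (Fin 2)) : ℝ :=
  2 * det2 (B - A) (C - B) / (‖B - A‖ * ‖C - B‖ * ‖C - A‖)

/-- The circular arc from `(−c, 0)` to `(c, 0)` whose tangent at `(−c, 0)`
makes angle `φ` with the positive `x`-axis, as a function of `x`. -/
noncomputable def arcA (c φ x : ℝ) : ℝ :=
  ((c ^ 2 - x ^ 2) * Real.sin φ) /
    (c * Real.cos φ + Real.sqrt (c ^ 2 - x ^ 2 * Real.sin φ ^ 2))

theorem arcA_of_sin_ne_zero {c φ x : ℝ} (hc : 0 < c) (hφ : 0 ≤ Real.cos φ)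
    (hs : Real.sin φ ≠ 0) (hx : x ∈ Set.Icc (-c) c) :
    arcA c φ x =
      (Real.sqrt (c ^ 2 - x ^ 2 * Real.sin φ ^ 2) - c * Real.cos φ) / Real.sin φ := by
  have hxc : x ^ 2 ≤ c ^ 2 := sq_le_sq' hx.1 hx.2
  have hsc := Real.sin_sq_add_cos_sq φ
  have hrad : 0 ≤ c ^ 2 - x ^ 2 * Real.sin φ ^ 2 := by
    nlinarith [sq_nonneg (Real.cos φ), sq_nonneg x]
  have hR := Real.sq_sqrt hrad
  have hR0 := Real.sqrt_nonneg (c ^ 2 - x ^ 2 * Real.sin φ ^ 2)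
  unfold arcA
  set R := Real.sqrt (c ^ 2 - x ^ 2 * Real.sin φ ^ 2)
  have hcc : 0 ≤ c * Real.cos φ := mul_nonneg hc.le hφ
  rcases (add_nonneg hcc hR0).eq_or_lt with h | h
  · have h1 : c * Real.cos φ = 0 := by linarith
    have h2 : R = 0 := by linarith
    simp [h1, h2]
  · rw [div_eq_div_iff h.ne' hs]
    have : (R - c * Real.cos φ) * (c * Real.cos φ + R) = R ^ 2 - c ^ 2 * Real.cos φ ^ 2 := by
      ring
    rw [this, hR]
    linear_combination c ^ 2 * hsc

theorem arcA_neg_left_end (c φ : ℝ) : arcA c φ (-c) = 0 := by simp [arcA]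

theorem arcA_right_end (c φ : ℝ) : arcA c φ c = 0 := by simp [arcA]

theorem arcA_neg_angle (c φ x : ℝ) : arcA c (-φ) x = -arcA c φ x := by
  simp [arcA, neg_div]

theorem arcA_neg_arg (c φ x : ℝ) : arcA c φ (-x) = arcA c φ x := by
  simp [arcA]

theorem arcA_of_sin_eq_zero {c φ : ℝ} (hs : Real.sin φ = 0) : arcA c φ = fun _ => 0 := by
  funext x
  simp [arcA, hs]

theorem continuousOn_arcA {c φ : ℝ} (hc : 0 < c) (hφ : 0 ≤ Real.cos φ) :
    ContinuousOn (arcA c φ) (Set.Icc (-c) c) := by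
  by_cases hs : Real.sin φ = 0
  · rw [arcA_of_sin_eq_zero hs]
    exact continuousOn_const
  · refine ContinuousOn.congr (Continuous.continuousOn ?_)
      fun x hx => arcA_of_sin_ne_zero hc hφ hs hx
    fun_prop

theorem radicand_pos {c x σ : ℝ} (hx : x ∈ Set.Ioo (-c) c) (hσ : σ ^ 2 ≤ 1) :
    0 < c ^ 2 - x ^ 2 * σ ^ 2 := by
  have : x ^ 2 < c ^ 2 := sq_lt_sq' hx.1 hx.2
  nlinarith [sq_nonneg x]

theorem hasDerivAt_arcA {c φ x : ℝ} (hc : 0 < c) (hφ : 0 ≤ Real.cos φ)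
    (hx : x ∈ Set.Ioo (-c) c) :
    HasDerivAt (arcA c φ)
      (-(Real.sin φ * x) / Real.sqrt (c ^ 2 - x ^ 2 * Real.sin φ ^ 2)) x := by
  by_cases hs : Real.sin φ = 0
  · rw [arcA_of_sin_eq_zero hs, hs]
    simpa using hasDerivAt_const x (0 : ℝ)
  · have hrad := radicand_pos hx (Real.sin_sq_le_one φ)
    have hR := Real.sqrt_pos.2 hrad
    have h1 : HasDerivAt (fun y : ℝ => c ^ 2 - y ^ 2 * Real.sin φ ^ 2)
        (-(2 * x * Real.sin φ ^ 2)) x := by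
      simpa using (((hasDerivAt_id x).pow 2).mul_const (Real.sin φ ^ 2)).const_sub (c ^ 2)
    have h2 := ((h1.sqrt hrad.ne').sub_const (c * Real.cos φ)).div_const (Real.sin φ)
    have h3 := h2.congr_of_eventuallyEq (f₁ := arcA c φ) (by
      filter_upwards [isOpen_Ioo.mem_nhds hx] with y hy
      exact arcA_of_sin_ne_zero hc hφ hs (Set.Ioo_subset_Icc_self hy))
    refine h3.congr_deriv ?_
    rw [div_div, div_eq_div_iff (mul_ne_zero (by positivity) hs) hR.ne']
    ring

/-- Comparison of slopes through sines: if `z ≤ c p`, then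
`z / √(c² - z²) ≤ p / √(1 - p²)`, with denominators cleared. -/
theorem mul_le_mul_of_sine_le {c p z R T : ℝ} (hc : 0 < c) (hR : 0 ≤ R) (hT : 0 ≤ T)
    (hR2 : R ^ 2 = c ^ 2 - z ^ 2) (hT2 : T ^ 2 + p ^ 2 = 1) (h : z ≤ c * p) :
    z * T ≤ p * R := by
  have key : (p * R) ^ 2 - (z * T) ^ 2 = (c * p) ^ 2 - z ^ 2 := by
    linear_combination p ^ 2 * hR2 - z ^ 2 * hT2
  rcases le_total 0 p with hp | hp
  · rcases le_total z 0 with hz | hz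
    · nlinarith [mul_nonneg hp hR, mul_nonneg (neg_nonneg.2 hz) hT]
    · refine le_of_sq_le_sq ?_ (mul_nonneg hp hR)
      nlinarith [mul_nonneg hc.le hp]
  · have hcp : c * p ≤ 0 := mul_nonpos_of_nonneg_of_nonpos hc.le hp
    have : -(p * R) ≤ -(z * T) := by
      refine le_of_sq_le_sq ?_ (by nlinarith)
      nlinarith
    linarith

theorem mul_lt_mul_of_sine_lt {c p z R T : ℝ} (hc : 0 < c) (hR : 0 ≤ R) (hT : 0 < T)
    (hR2 : R ^ 2 = c ^ 2 - z ^ 2) (hT2 : T ^ 2 + p ^ 2 = 1) (h : z < c * p) :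
    z * T < p * R := by
  refine lt_of_le_of_ne (mul_le_mul_of_sine_le hc hR hT.le hR2 hT2 h.le) fun he => ?_
  have key : (p * R) ^ 2 - (z * T) ^ 2 = (c * p) ^ 2 - z ^ 2 := by
    linear_combination p ^ 2 * hR2 - z ^ 2 * hT2
  rw [he, sub_self] at key
  have hz : z = -(c * p) := by
    have : (c * p - z) * (c * p + z) = 0 := by linear_combination -key
    rcases mul_eq_zero.1 this with h' | h' <;> linarith
  have hp : 0 < p := by
    by_contra hp
    nlinarith
  have hzT : z * T < 0 := by
    rw [hz]
    nlinarith [mul_pos (mul_pos hc hp) hT]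
  nlinarith [mul_nonneg hp.le hR]

/-- A unit-speed curve `(X, Y)` on `[a, b]` with `X' = T > 0`, `Y' = p` and signed curvature `k`,
in the coordinates in which its endpoints are `(-c, 0)` and `(c, 0)`. -/
structure IsChordGraph (X Y T p k : ℝ → ℝ) (c a b : ℝ) : Prop where
  lt : a < b
  hasDerivAt_fst : ∀ s, HasDerivAt X (T s) s
  hasDerivAt_snd : ∀ s, HasDerivAt Y (p s) s
  hasDerivAt_sine : ∀ s, HasDerivAt p (k s * T s) s
  pos : ∀ s ∈ Set.Icc a b, 0 < T s
  unit : ∀ s, T s ^ 2 + p s ^ 2 = 1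
  fst_left : X a = -c
  fst_right : X b = c
  snd_left : Y a = 0
  snd_right : Y b = 0

namespace IsChordGraph

variable {X Y T p k : ℝ → ℝ} {c a b φ : ℝ}

theorem strictMonoOn (h : IsChordGraph X Y T p k c a b) : StrictMonoOn X (Set.Icc a b) := by
  refine strictMonoOn_of_deriv_pos (convex_Icc a b)
    (fun s _ => (h.hasDerivAt_fst s).continuousAt.continuousWithinAt) fun s hs => ?_
  rw [(h.hasDerivAt_fst s).deriv]
  exact h.pos s (interior_subset hs)

theorem half_chord_pos (h : IsChordGraph X Y T p k c a b) : 0 < c := by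
  have := h.strictMonoOn (Set.left_mem_Icc.2 h.lt.le) (Set.right_mem_Icc.2 h.lt.le) h.lt
  rw [h.fst_left, h.fst_right] at this
  linarith

theorem mapsTo_Icc (h : IsChordGraph X Y T p k c a b) :
    Set.MapsTo X (Set.Icc a b) (Set.Icc (-c) c) := by
  have := h.strictMonoOn.monotoneOn.mapsTo_Icc
  rwa [h.fst_left, h.fst_right] at this

theorem mapsTo_Ioo (h : IsChordGraph X Y T p k c a b) :
    Set.MapsTo X (Set.Ioo a b) (Set.Ioo (-c) c) := by
  have := h.strictMonoOn.mapsTo_Ioo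
  rwa [h.fst_left, h.fst_right] at this

theorem continuousOn_gap (h : IsChordGraph X Y T p k c a b) (hφ : 0 ≤ Real.cos φ) :
    ContinuousOn (fun s => Y s - arcA c φ (X s)) (Set.Icc a b) :=
  ContinuousOn.sub (fun s _ => (h.hasDerivAt_snd s).continuousAt.continuousWithinAt)
    ((continuousOn_arcA h.half_chord_pos hφ).comp
      (fun s _ => (h.hasDerivAt_fst s).continuousAt.continuousWithinAt) h.mapsTo_Icc)

theorem exists_hasDerivAt_gap (h : IsChordGraph X Y T p k c a b) (hφ : 0 ≤ Real.cos φ)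
    {s : ℝ} (hs : s ∈ Set.Ioo a b) :
    ∃ g, HasDerivAt (fun s => Y s - arcA c φ (X s)) g s ∧
      (0 < c * p s + Real.sin φ * X s → 0 < g) ∧
      (0 < g → 0 < c * p s + Real.sin φ * X s) ∧
      (g < 0 → c * p s + Real.sin φ * X s < 0) := by
  have hc := h.half_chord_pos
  have hX := h.mapsTo_Ioo hs
  have hrad := radicand_pos hX (Real.sin_sq_le_one φ)
  have hRpos := Real.sqrt_pos.2 hrad
  have hR2 := Real.sq_sqrt hrad.le
  have hT := h.pos s (Set.Ioo_subset_Icc_self hs)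
  have hu := h.unit s
  refine ⟨_, (h.hasDerivAt_snd s).sub ((hasDerivAt_arcA hc hφ hX).comp s (h.hasDerivAt_fst s)), ?_⟩
  set R := Real.sqrt (c ^ 2 - X s ^ 2 * Real.sin φ ^ 2)
  have hg : p s - -(Real.sin φ * X s) / R * T s =
      (p s * R - -(Real.sin φ * X s) * T s) / R := by
    field_simp
  rw [hg]
  refine ⟨fun h0 => div_pos (sub_pos.2 ?_) hRpos, fun h0 => ?_, fun h0 => ?_⟩
  · exact mul_lt_mul_of_sine_lt hc hRpos.le hT (by rw [hR2]; ring) hu (by linarith)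
  · by_contra hcon
    rw [div_pos_iff_of_pos_right hRpos] at h0
    have := mul_le_mul_of_sine_le (p := -p s) (z := Real.sin φ * X s) hc hRpos.le hT.le
      (by rw [hR2]; ring) (by rw [neg_sq]; exact hu) (by linarith)
    linarith
  · by_contra hcon
    rw [div_lt_iff₀ hRpos, zero_mul] at h0
    have := mul_le_mul_of_sine_le (p := p s) (z := -(Real.sin φ * X s)) hc hRpos.le hT.le
      (by rw [hR2]; ring) hu (by linarith)
    linarith

theorem exists_sine_le (h : IsChordGraph X Y T p k c a b) (q : ℝ) :
    ∃ s ∈ Set.Icc a b, p s - q * X s ≤ 0 := by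
  by_contra! hpos
  have hc := h.half_chord_pos
  have ha := hpos a (Set.left_mem_Icc.2 h.lt.le)
  have hb := hpos b (Set.right_mem_Icc.2 h.lt.le)
  rw [h.fst_left] at ha
  rw [h.fst_right] at hb
  have hpa : p a ≤ 1 := by nlinarith [h.unit a, sq_nonneg (T a)]
  have hpb : p b ≤ 1 := by nlinarith [h.unit b, sq_nonneg (T b)]
  have hsin : Real.sin (Real.arcsin (-(q * c))) = -(q * c) :=
    Real.sin_arcsin (by linarith) (by linarith)
  have hcos := Real.cos_arcsin_nonneg (-(q * c))
  choose! g hg hg' using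
    fun s (hs : s ∈ Set.Ioo a b) => h.exists_hasDerivAt_gap hcos hs
  obtain ⟨s, hs, h0⟩ := exists_hasDerivAt_eq_zero h.lt (h.continuousOn_gap hcos)
    (by simp [h.fst_left, h.fst_right, h.snd_left, h.snd_right, arcA_neg_left_end,
      arcA_right_end]) hg
  have := (hg' s hs).1 (by
    rw [hsin]
    nlinarith [mul_pos hc (hpos s (Set.Ioo_subset_Icc_self hs))])
  linarith

theorem hasDerivAt_sine_gap (h : IsChordGraph X Y T p k c a b) (q s : ℝ) :
    HasDerivAt (fun s => p s - q * X s) ((k s - q) * T s) s := by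
  exact ((h.hasDerivAt_sine s).sub ((h.hasDerivAt_fst s).const_mul q)).congr_deriv (by ring)

theorem sine_left_le (h : IsChordGraph X Y T p k c a b) {q : ℝ}
    (hk : ∀ s ∈ Set.Icc a b, q ≤ k s) : p a ≤ -(q * c) := by
  have hmono : MonotoneOn (fun s => p s - q * X s) (Set.Icc a b) := by
    refine monotoneOn_of_deriv_nonneg (convex_Icc a b)
      (fun s _ => (h.hasDerivAt_sine_gap q s).continuousAt.continuousWithinAt)
      (fun s _ => (h.hasDerivAt_sine_gap q s).differentiableAt.differentiableWithinAt)
      fun s hs => ?_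
    rw [(h.hasDerivAt_sine_gap q s).deriv]
    exact mul_nonneg (sub_nonneg.2 (hk s (interior_subset hs))) (h.pos s (interior_subset hs)).le
  obtain ⟨s, hs, hs0⟩ := h.exists_sine_le q
  have := hmono (Set.left_mem_Icc.2 h.lt.le) hs hs.1
  simp only [h.fst_left] at this
  linarith

theorem sine_right_le (h : IsChordGraph X Y T p k c a b) {q : ℝ}
    (hk : ∀ s ∈ Set.Icc a b, k s ≤ q) : p b ≤ q * c := by
  have hanti : AntitoneOn (fun s => p s - q * X s) (Set.Icc a b) := by
    refine antitoneOn_of_deriv_nonpos (convex_Icc a b)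
      (fun s _ => (h.hasDerivAt_sine_gap q s).continuousAt.continuousWithinAt)
      (fun s _ => (h.hasDerivAt_sine_gap q s).differentiableAt.differentiableWithinAt)
      fun s hs => ?_
    rw [(h.hasDerivAt_sine_gap q s).deriv]
    exact mul_nonpos_of_nonpos_of_nonneg (sub_nonpos.2 (hk s (interior_subset hs)))
      (h.pos s (interior_subset hs)).le
  obtain ⟨s, hs, hs0⟩ := h.exists_sine_le q
  have := hanti hs (Set.right_mem_Icc.2 h.lt.le) hs.2
  simp only [h.fst_right] at this
  linarith

/-- A graph of nondecreasing curvature which leaves its chord at an angle at most `φ` stays below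
the circular arc of angle `φ`. -/
theorem le_arcA (h : IsChordGraph X Y T p k c a b) (hφ : 0 ≤ Real.cos φ)
    (hk : MonotoneOn k (Set.Icc a b)) (ha : p a ≤ Real.sin φ) {t : ℝ} (ht : t ∈ Set.Icc a b) :
    Y t ≤ arcA c φ (X t) := by
  by_contra! hlt
  have hc := h.half_chord_pos
  have hat : a < t := lt_of_le_of_ne ht.1 (by
    rintro rfl
    rw [h.fst_left, h.snd_left, arcA_neg_left_end] at hlt
    exact hlt.false)
  have htb : t < b := lt_of_le_of_ne ht.2 (by
    rintro rfl
    rw [h.fst_right, h.snd_right, arcA_right_end] at hlt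
    exact hlt.false)
  choose! g hg hg' using
    fun s (hs : s ∈ Set.Ioo a b) => h.exists_hasDerivAt_gap hφ hs
  have hcont := h.continuousOn_gap hφ
  obtain ⟨t₁, ht₁, hgt₁⟩ := exists_hasDerivAt_eq_slope _ g hat
    (hcont.mono (Set.Icc_subset_Icc_right htb.le)) fun s hs => hg s ⟨hs.1, hs.2.trans htb⟩
  obtain ⟨t₂, ht₂, hgt₂⟩ := exists_hasDerivAt_eq_slope _ g htb
    (hcont.mono (Set.Icc_subset_Icc_left hat.le)) fun s hs => hg s ⟨hat.trans hs.1, hs.2⟩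
  have hpos : 0 < c * p t₁ + Real.sin φ * X t₁ := by
    refine (hg' t₁ ⟨ht₁.1, ht₁.2.trans htb⟩).2.1 ?_
    rw [hgt₁, h.fst_left, h.snd_left, arcA_neg_left_end]
    exact div_pos (by linarith) (by linarith)
  have hneg : c * p t₂ + Real.sin φ * X t₂ < 0 := by
    refine (hg' t₂ ⟨hat.trans ht₂.1, ht₂.2⟩).2.2 ?_
    rw [hgt₂, h.fst_right, h.snd_right, arcA_right_end]
    exact div_neg_of_neg_of_pos (by linarith) (by linarith)
  have hder : ∀ s, HasDerivAt (fun s => c * p s + Real.sin φ * X s)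
      ((c * k s + Real.sin φ) * T s) s := fun s => by
    exact (((h.hasDerivAt_sine s).const_mul c).add
      ((h.hasDerivAt_fst s).const_mul (Real.sin φ))).congr_deriv (by ring)
  have hdc : Continuous fun s => c * p s + Real.sin φ * X s :=
    continuous_iff_continuousAt.2 fun s => (hder s).continuousAt
  obtain ⟨r₁, hr₁, hgr₁⟩ := exists_hasDerivAt_eq_slope _ _ ht₁.1 hdc.continuousOn
    fun s _ => hder s
  obtain ⟨r₂, hr₂, hgr₂⟩ := exists_hasDerivAt_eq_slope _ _ (ht₁.2.trans ht₂.1) hdc.continuousOn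
    fun s _ => hder s
  have hr₁mem : r₁ ∈ Set.Icc a b := ⟨hr₁.1.le, by linarith [hr₁.2, ht₁.2]⟩
  have hr₂mem : r₂ ∈ Set.Icc a b :=
    ⟨by linarith [hr₂.1, ht₁.1], by linarith [hr₂.2, ht₂.2]⟩
  have h₁ : 0 < (c * k r₁ + Real.sin φ) * T r₁ := by
    rw [hgr₁, h.fst_left]
    exact div_pos (by nlinarith) (by linarith [ht₁.1])
  have h₂ : (c * k r₂ + Real.sin φ) * T r₂ < 0 := by
    rw [hgr₂]
    exact div_neg_of_neg_of_pos (by linarith) (by linarith [ht₁.2, ht₂.1])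
  have h₁' := pos_of_mul_pos_left h₁ (h.pos r₁ hr₁mem).le
  have h₂' := neg_of_mul_neg_left h₂ (h.pos r₂ hr₂mem).le
  have := hk hr₁mem hr₂mem (hr₁.2.trans hr₂.1).le
  nlinarith

end IsChordGraph

theorem inner_eq_coords (a b : EuclideanSpace ℝ (Fin 2)) :
    ⟪a, b⟫_ℝ = a 0 * b 0 + a 1 * b 1 := by
  simp [PiLp.inner_apply, Fin.sum_univ_two, mul_comm]

theorem norm_sq_eq_coords (a : EuclideanSpace ℝ (Fin 2)) : ‖a‖ ^ 2 = a 0 ^ 2 + a 1 ^ 2 := by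
  simp [EuclideanSpace.real_norm_sq_eq, Fin.sum_univ_two]

theorem hasDerivAt_coord {γ : ℝ → EuclideanSpace ℝ (Fin 2)} {γ' : EuclideanSpace ℝ (Fin 2)}
    {s : ℝ} (h : HasDerivAt γ γ' s) (i : Fin 2) : HasDerivAt (fun s => γ s i) (γ' i) s :=
  (EuclideanSpace.proj (𝕜 := ℝ) i).hasFDerivAt.comp_hasDerivAt s h

theorem deriv_inner_deriv_deriv {γ : ℝ → EuclideanSpace ℝ (Fin 2)} {s : ℝ}
    (h : DifferentiableAt ℝ (deriv γ) s) (hunit : ∀ s, ‖deriv γ s‖ = 1) :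
    deriv γ s 0 * deriv (deriv γ) s 0 + deriv γ s 1 * deriv (deriv γ) s 1 = 0 := by
  have h0 := hasDerivAt_coord h.hasDerivAt 0
  have h1 := hasDerivAt_coord h.hasDerivAt 1
  have hsum := (h0.pow 2).add (h1.pow 2)
  have hconst : ((fun s => deriv γ s 0) ^ 2 + (fun s => deriv γ s 1) ^ 2 : ℝ → ℝ) =
      fun _ => 1 := by
    funext r
    have := norm_sq_eq_coords (deriv γ r)
    rw [hunit r, one_pow] at this
    exact this.symm
  rw [hconst] at hsum
  have := hsum.unique (hasDerivAt_const s (1 : ℝ))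
  norm_num at this
  linarith

theorem isChordGraph_of_unit_speed {γ : ℝ → EuclideanSpace ℝ (Fin 2)} (hγ : ContDiff ℝ 2 γ)
    (hunit : ∀ s, ‖deriv γ s‖ = 1) {a b : ℝ} (hab : a < b) (hne : γ a ≠ γ b)
    (hproj : ∀ s ∈ Set.Icc a b, 0 < ⟪deriv γ s, ‖γ b - γ a‖⁻¹ • (γ b - γ a)⟫_ℝ) :
    IsChordGraph
      (fun s => ⟪γ s - (2 : ℝ)⁻¹ • (γ a + γ b), ‖γ b - γ a‖⁻¹ • (γ b - γ a)⟫_ℝ)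
      (fun s => det2 (‖γ b - γ a‖⁻¹ • (γ b - γ a)) (γ s - (2 : ℝ)⁻¹ • (γ a + γ b)))
      (fun s => ⟪deriv γ s, ‖γ b - γ a‖⁻¹ • (γ b - γ a)⟫_ℝ)
      (fun s => det2 (‖γ b - γ a‖⁻¹ • (γ b - γ a)) (deriv γ s))
      (signedCurv γ) (‖γ b - γ a‖ / 2) a b := by
  have hl : 0 < ‖γ b - γ a‖ := norm_pos_iff.2 (sub_ne_zero.2 hne.symm)
  have hl2 := norm_sq_eq_coords (γ b - γ a)
  simp only [PiLp.sub_apply] at hl2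
  have he : ‖‖γ b - γ a‖⁻¹ • (γ b - γ a)‖ = 1 := by
    rw [norm_smul, norm_inv, norm_norm, inv_mul_cancel₀ hl.ne']
  have hd : ∀ s, HasDerivAt γ (deriv γ s) s := fun s =>
    (hγ.differentiable (by norm_num) s).hasDerivAt
  have hdd : ∀ s, HasDerivAt (deriv γ) (deriv (deriv γ) s) s := fun s =>
    ((hγ.iterate_deriv' 1 1).differentiable (by norm_num) s).hasDerivAt
  have hX : ∀ e m : EuclideanSpace ℝ (Fin 2), ∀ s,
      HasDerivAt (fun s => ⟪γ s - m, e⟫_ℝ) ⟪deriv γ s, e⟫_ℝ s := fun e m s => by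
    simp only [inner_eq_coords, PiLp.sub_apply]
    exact (((hasDerivAt_coord (hd s) 0).sub_const _).mul_const _).add
      (((hasDerivAt_coord (hd s) 1).sub_const _).mul_const _)
  have hY : ∀ e m : EuclideanSpace ℝ (Fin 2), ∀ s,
      HasDerivAt (fun s => det2 e (γ s - m)) (det2 e (deriv γ s)) s := fun e m s => by
    simp only [det2, PiLp.sub_apply]
    exact (((hasDerivAt_coord (hd s) 1).sub_const _).const_mul _).sub
      (((hasDerivAt_coord (hd s) 0).sub_const _).const_mul _)
  have hp : ∀ e : EuclideanSpace ℝ (Fin 2), ∀ s,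
      HasDerivAt (fun s => det2 e (deriv γ s)) (signedCurv γ s * ⟪deriv γ s, e⟫_ℝ) s :=
    fun e s => by
    have horth := deriv_inner_deriv_deriv (hdd s).differentiableAt hunit
    have hu := norm_sq_eq_coords (deriv γ s)
    rw [hunit s] at hu
    simp only [det2, signedCurv, inner_eq_coords]
    refine (((hasDerivAt_coord (hdd s) 1).const_mul _).sub
      ((hasDerivAt_coord (hdd s) 0).const_mul _)).congr_deriv ?_
    linear_combination (e 0 * deriv (deriv γ) s 1 - e 1 * deriv (deriv γ) s 0) * hu +
      (e 0 * deriv γ s 1 - e 1 * deriv γ s 0) * horth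
  refine ⟨hab, hX _ _, hY _ _, hp _, hproj, fun s => ?_, ?_, ?_, ?_, ?_⟩
  · have hu := norm_sq_eq_coords (deriv γ s)
    have he2 := norm_sq_eq_coords (‖γ b - γ a‖⁻¹ • (γ b - γ a))
    rw [hunit s] at hu
    rw [he] at he2
    simp only [det2, inner_eq_coords]
    generalize ‖γ b - γ a‖⁻¹ • (γ b - γ a) = e at *
    linear_combination -hu - (deriv γ s 0 ^ 2 + deriv γ s 1 ^ 2) * he2
  · simp only [inner_eq_coords, PiLp.sub_apply, PiLp.add_apply, PiLp.smul_apply, smul_eq_mul]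
    field_simp
    linear_combination hl2
  · simp only [inner_eq_coords, PiLp.sub_apply, PiLp.add_apply, PiLp.smul_apply, smul_eq_mul]
    field_simp
    linear_combination -hl2
  · simp only [det2, PiLp.sub_apply, PiLp.add_apply, PiLp.smul_apply, smul_eq_mul]
    ring
  · simp only [det2, PiLp.sub_apply, PiLp.add_apply, PiLp.smul_apply, smul_eq_mul]
    ring

/-- If the direction `|v|² d + |d|² v`, tangent at the middle vertex to the circle through the
vertices of the path with steps `d` and `v`, is counterclockwise from `T`, then the sine of the
angle from `v` to `T` is at most the sine of the angle from `v` to this tangent. -/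
theorem sine_le_of_tangent {d v T : EuclideanSpace ℝ (Fin 2)} (hd : d ≠ 0) (hv : v ≠ 0)
    (hdv : d + v ≠ 0) (hT : ‖T‖ = 1) (hTv : 0 < ⟪T, v⟫_ℝ) (hturn : 0 ≤ ‖d‖ ^ 2 + ⟪d, v⟫_ℝ)
    (h : ‖v‖ ^ 2 * det2 d T + ‖d‖ ^ 2 * det2 v T ≤ 0) :
    det2 v T / ‖v‖ ≤ -(det2 d v / (‖d‖ * ‖d + v‖)) ∧
      (det2 d v / (‖d‖ * ‖d + v‖)) ^ 2 ≤ 1 := by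
  have hd0 := norm_pos_iff.2 hd
  have hv0 := norm_pos_iff.2 hv
  have hw0 := norm_pos_iff.2 hdv
  have hT2 := norm_sq_eq_coords T
  have hd2 := norm_sq_eq_coords d
  have hv2 := norm_sq_eq_coords v
  have hw2 := norm_sq_eq_coords (d + v)
  rw [hT] at hT2
  simp only [PiLp.add_apply] at hw2
  have hcs : ((‖d‖ ^ 2 + ⟪d, v⟫_ℝ) / (‖d‖ * ‖d + v‖)) ^ 2 =
      1 ^ 2 - (-(det2 d v / (‖d‖ * ‖d + v‖))) ^ 2 := by
    have : (‖d‖ ^ 2 + ⟪d, v⟫_ℝ) ^ 2 + det2 d v ^ 2 = ‖d‖ ^ 2 * ‖d + v‖ ^ 2 := by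
      rw [hw2, hd2, det2, inner_eq_coords]
      ring
    field_simp
    linear_combination this
  have hu : (⟪T, v⟫_ℝ / ‖v‖) ^ 2 + (det2 v T / ‖v‖) ^ 2 = 1 := by
    have : ⟪T, v⟫_ℝ ^ 2 + det2 v T ^ 2 = ‖v‖ ^ 2 := by
      rw [hv2, det2, inner_eq_coords]
      linear_combination -(v 0 ^ 2 + v 1 ^ 2) * hT2
    field_simp
    linear_combination this
  refine ⟨?_, by nlinarith [sq_nonneg ((‖d‖ ^ 2 + ⟪d, v⟫_ℝ) / (‖d‖ * ‖d + v‖))]⟩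
  by_contra! hlt
  have key := mul_lt_mul_of_sine_lt one_pos (by positivity) (div_pos hTv hv0) hcs hu
    (by rw [one_mul]; exact hlt)
  have hid : (‖d‖ ^ 2 + ⟪d, v⟫_ℝ) * det2 v T + det2 d v * ⟪T, v⟫_ℝ =
      ‖v‖ ^ 2 * det2 d T + ‖d‖ ^ 2 * det2 v T := by
    rw [hv2]
    simp only [det2, inner_eq_coords]
    ring
  have hdiff : det2 v T / ‖v‖ * ((‖d‖ ^ 2 + ⟪d, v⟫_ℝ) / (‖d‖ * ‖d + v‖)) -
      -(det2 d v / (‖d‖ * ‖d + v‖)) * (⟪T, v⟫_ℝ / ‖v‖) =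
      (‖v‖ ^ 2 * det2 d T + ‖d‖ ^ 2 * det2 v T) / (‖v‖ * (‖d‖ * ‖d + v‖)) := by
    rw [← hid]
    field_simp
    ring
  have : (‖v‖ ^ 2 * det2 d T + ‖d‖ ^ 2 * det2 v T) / (‖v‖ * (‖d‖ * ‖d + v‖)) ≤ 0 :=
    div_nonpos_of_nonpos_of_nonneg h (by positivity)
  linarith

theorem det2_inv_norm_smul (v T : EuclideanSpace ℝ (Fin 2)) :
    det2 (‖v‖⁻¹ • v) T = det2 v T / ‖v‖ := by
  simp only [det2, PiLp.smul_apply, smul_eq_mul]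
  ring

theorem det2_le_arcA_of_monotoneOn {γ : ℝ → EuclideanSpace ℝ (Fin 2)} (hγ : ContDiff ℝ 2 γ)
    (hunit : ∀ s, ‖deriv γ s‖ = 1) {s₀ s₁ s₂ : ℝ} (h01 : s₀ < s₁) (h12 : s₁ < s₂)
    (hmono : MonotoneOn (signedCurv γ) (Set.Icc s₀ s₂))
    (hne01 : γ s₀ ≠ γ s₁) (hne12 : γ s₁ ≠ γ s₂) (hne02 : γ s₀ ≠ γ s₂)
    (hproj₀ : ∀ s ∈ Set.Icc s₀ s₁, 0 < ⟪deriv γ s, ‖γ s₁ - γ s₀‖⁻¹ • (γ s₁ - γ s₀)⟫_ℝ)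
    (hproj₁ : ∀ s ∈ Set.Icc s₁ s₂, 0 < ⟪deriv γ s, ‖γ s₂ - γ s₁‖⁻¹ • (γ s₂ - γ s₁)⟫_ℝ)
    (hturn : 0 ≤ ‖γ s₁ - γ s₀‖ ^ 2 + ⟪γ s₁ - γ s₀, γ s₂ - γ s₁⟫_ℝ)
    {s : ℝ} (hs : s ∈ Set.Icc s₁ s₂) :
    det2 (‖γ s₂ - γ s₁‖⁻¹ • (γ s₂ - γ s₁)) (γ s - (2 : ℝ)⁻¹ • (γ s₁ + γ s₂)) ≤
      arcA (‖γ s₂ - γ s₁‖ / 2)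
        (Real.arcsin (-(‖γ s₂ - γ s₁‖ / 2 * q3 (γ s₀) (γ s₁) (γ s₂))))
        ⟪γ s - (2 : ℝ)⁻¹ • (γ s₁ + γ s₂), ‖γ s₂ - γ s₁‖⁻¹ • (γ s₂ - γ s₁)⟫_ℝ := by
  have g0 := isChordGraph_of_unit_speed hγ hunit h01 hne01 hproj₀
  have g1 := isChordGraph_of_unit_speed hγ hunit h12 hne12 hproj₁
  have hmem : s₁ ∈ Set.Icc s₀ s₂ := ⟨h01.le, h12.le⟩
  have hend := g0.sine_right_le fun r hr => hmono ⟨hr.1, hr.2.trans h12.le⟩ hmem hr.2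
  have hstart := g1.sine_left_le fun r hr => hmono hmem ⟨h01.le.trans hr.1, hr.2⟩ hr.1
  simp only [det2_inv_norm_smul] at hend hstart
  have hd : γ s₁ - γ s₀ ≠ 0 := sub_ne_zero.2 hne01.symm
  have hv : γ s₂ - γ s₁ ≠ 0 := sub_ne_zero.2 hne12.symm
  have hw : γ s₁ - γ s₀ + (γ s₂ - γ s₁) = γ s₂ - γ s₀ := by abel
  have hd0 := norm_pos_iff.2 hd
  have hv0 := norm_pos_iff.2 hv
  have hw0 : 0 < ‖γ s₂ - γ s₀‖ := norm_pos_iff.2 (sub_ne_zero.2 hne02.symm)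
  rw [div_le_iff₀ hd0] at hend
  rw [div_le_iff₀ hv0] at hstart
  have hTv := hproj₁ s₁ (Set.left_mem_Icc.2 h12.le)
  rw [real_inner_smul_right] at hTv
  obtain ⟨hle, hsq⟩ := sine_le_of_tangent hd hv (hw ▸ sub_ne_zero.2 hne02.symm) (hunit s₁)
    (pos_of_mul_pos_right hTv (by positivity)) hturn
    (by nlinarith [mul_le_mul_of_nonneg_left hend (sq_nonneg ‖γ s₂ - γ s₁‖),
          mul_le_mul_of_nonneg_left hstart (sq_nonneg ‖γ s₁ - γ s₀‖)])
  rw [hw] at hle hsq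
  have hq : ‖γ s₂ - γ s₁‖ / 2 * q3 (γ s₀) (γ s₁) (γ s₂) =
      det2 (γ s₁ - γ s₀) (γ s₂ - γ s₁) / (‖γ s₁ - γ s₀‖ * ‖γ s₂ - γ s₀‖) := by
    unfold q3
    field_simp
  rw [hq]
  obtain ⟨hl, hr⟩ := abs_le.1 ((sq_le_one_iff_abs_le_one _).1 hsq)
  refine g1.le_arcA (Real.cos_arcsin_nonneg _)
    (hmono.mono (Set.Icc_subset_Icc_left h01.le)) ?_ hs
  rw [Real.sin_arcsin (by linarith) (by linarith), det2_inv_norm_smul]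
  exact hle

theorem deriv_comp_neg_fun (γ : ℝ → EuclideanSpace ℝ (Fin 2)) :
    deriv (fun s => γ (-s)) = fun s => -deriv γ (-s) := by
  funext s
  exact deriv_comp_neg γ s

theorem signedCurv_comp_neg (γ : ℝ → EuclideanSpace ℝ (Fin 2)) (s : ℝ) :
    signedCurv (fun s => γ (-s)) s = -signedCurv γ (-s) := by
  have : deriv (fun s => -deriv γ (-s)) s = deriv (deriv γ) (-s) := by
    rw [deriv.fun_neg, deriv_comp_neg (deriv γ) s, neg_neg]
  rw [signedCurv, deriv_comp_neg_fun, this]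
  simp only [signedCurv, det2, PiLp.neg_apply]
  ring

theorem q3_reverse (A B C : EuclideanSpace ℝ (Fin 2)) : q3 C B A = -q3 A B C := by
  have : det2 (B - C) (A - B) = -det2 (B - A) (C - B) := by
    simp only [det2, PiLp.sub_apply]
    ring
  rw [q3, q3, this, norm_sub_rev B C, norm_sub_rev A B, norm_sub_rev A C]
  ring

/-- Proposition 1: the spiral segment between `P₁` and `P₂` lies in the lens
on the chord `P₁P₂` bounded by the circular arcs with tangent angles
`ξ = arcsin(−c·q(P₀,P₁,P₂))` and `−η = −arcsin(c·q(P₁,P₂,P₃))`. -/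
theorem prop1_lens_bound_on_chord
    (γ : ℝ → EuclideanSpace ℝ (Fin 2)) (hγ : ContDiff ℝ 2 γ)
    (hunit : ∀ s, ‖deriv γ s‖ = 1)
    (s₀ s₁ s₂ s₃ : ℝ) (h01 : s₀ < s₁) (h12 : s₁ < s₂) (h23 : s₂ < s₃)
    (hmono : MonotoneOn (signedCurv γ) (Set.Icc s₀ s₃))
    (P₀ P₁ P₂ P₃ : EuclideanSpace ℝ (Fin 2))
    (hP₀ : P₀ = γ s₀) (hP₁ : P₁ = γ s₁) (hP₂ : P₂ = γ s₂) (hP₃ : P₃ = γ s₃)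
    (hdist : ([P₀, P₁, P₂, P₃] : List (EuclideanSpace ℝ (Fin 2))).Pairwise (· ≠ ·))
    (v : EuclideanSpace ℝ (Fin 2)) (hv : v = P₂ - P₁)
    (c : ℝ) (hc : c = ‖v‖ / 2)
    (vhat : EuclideanSpace ℝ (Fin 2)) (hvhat : vhat = ‖v‖⁻¹ • v)
    (M : EuclideanSpace ℝ (Fin 2)) (hM : M = (2 : ℝ)⁻¹ • (P₁ + P₂))
    (hproj₀ : ∀ s ∈ Set.Icc s₀ s₁, 0 < ⟪deriv γ s, ‖P₁ - P₀‖⁻¹ • (P₁ - P₀)⟫_ℝ)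
    (hproj₁ : ∀ s ∈ Set.Icc s₁ s₂, 0 < ⟪deriv γ s, ‖P₂ - P₁‖⁻¹ • (P₂ - P₁)⟫_ℝ)
    (hproj₂ : ∀ s ∈ Set.Icc s₂ s₃, 0 < ⟪deriv γ s, ‖P₃ - P₂‖⁻¹ • (P₃ - P₂)⟫_ℝ)
    (hturn₁ : 0 ≤ ‖P₁ - P₀‖ ^ 2 + ⟪P₁ - P₀, P₂ - P₁⟫_ℝ)
    (hturn₂ : 0 ≤ ‖P₃ - P₂‖ ^ 2 + ⟪P₂ - P₁, P₃ - P₂⟫_ℝ)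
    (ξ η : ℝ)
    (hξ : ξ = Real.arcsin (-(c * q3 P₀ P₁ P₂)))
    (hη : η = Real.arcsin (c * q3 P₁ P₂ P₃)) :
    ∀ s ∈ Set.Icc s₁ s₂,
      arcA c (-η) ⟪γ s - M, vhat⟫_ℝ ≤ det2 vhat (γ s - M) ∧
      det2 vhat (γ s - M) ≤ arcA c ξ ⟪γ s - M, vhat⟫_ℝ := by
  subst hη hξ hM hvhat hc hv hP₀ hP₁ hP₂ hP₃
  simp only [List.pairwise_cons, List.mem_cons, List.not_mem_nil, or_false, forall_eq_or_imp,
    forall_eq] at hdist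
  obtain ⟨⟨hne01, hne02, -⟩, ⟨hne12, hne13⟩, hne23, -⟩ := hdist
  intro s hs
  refine ⟨?_, det2_le_arcA_of_monotoneOn hγ hunit h01 h12
    (hmono.mono (Set.Icc_subset_Icc_right h23.le)) hne01 hne12 hne02 hproj₀ hproj₁ hturn₁ hs⟩
  have hsmul : ∀ A B : EuclideanSpace ℝ (Fin 2),
      ‖A - B‖⁻¹ • (A - B) = -(‖B - A‖⁻¹ • (B - A)) := fun A B => by
    rw [norm_sub_rev, ← smul_neg, neg_sub]
  have hrev := det2_le_arcA_of_monotoneOn (γ := fun s => γ (-s)) (hγ.comp contDiff_neg)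
    (fun s => by rw [deriv_comp_neg_fun, norm_neg, hunit]) (neg_lt_neg h23) (neg_lt_neg h12)
    (fun a ha b hb hab => by
      rw [signedCurv_comp_neg, signedCurv_comp_neg]
      exact neg_le_neg (hmono ⟨by linarith [hb.2], by linarith [hb.1]⟩
        ⟨by linarith [ha.2], by linarith [ha.1]⟩ (neg_le_neg hab)))
    (by simpa using hne23.symm) (by simpa using hne12.symm) (by simpa using hne13.symm)
    (fun s hs => by
      simp only [neg_neg]
      rw [deriv_comp_neg_fun, hsmul, inner_neg_neg]
      exact hproj₂ (-s) ⟨by linarith [hs.2], by linarith [hs.1]⟩)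
    (fun s hs => by
      simp only [neg_neg]
      rw [deriv_comp_neg_fun, hsmul, inner_neg_neg]
      exact hproj₁ (-s) ⟨by linarith [hs.2], by linarith [hs.1]⟩)
    (by
      simp only [neg_neg]
      rw [norm_sub_rev, ← neg_sub (γ s₃), ← neg_sub (γ s₂) (γ s₁), inner_neg_neg,
        real_inner_comm]
      exact hturn₂)
    (s := -s) ⟨by linarith [hs.2], by linarith [hs.1]⟩
  simp only [neg_neg] at hrev
  have hdet : ∀ e w : EuclideanSpace ℝ (Fin 2), det2 (-e) w = -det2 e w := fun e w => by
    simp only [det2, PiLp.neg_apply]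
    ring
  rw [hsmul, add_comm (γ s₂), inner_neg_right, arcA_neg_arg, hdet, q3_reverse, mul_neg,
    neg_neg, norm_sub_rev (γ s₁)] at hrev
  rw [arcA_neg_angle]
  linarith
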